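/- arXiv:0805.0521 — 3 statements merged into one kernel-verified Lean document; each statement's English description precedes it below -/
import Mathlib

section
/- For every σ > 0, A > 0 and every average-to-peak ratio α with 1/2 < α ≤ 1, the capacity satisfies C(A, αA) = C(A, A/2). In other words, whenever α > 1/2 the average-power constraint is inactive and the capacity equals its value at average power A/2. -/
open MeasureTheory ProbabilityTheory Real Filter Set
open scoped Classical Topology

/-- Kullback--Leibler divergence (in nats), valued in the extended reals:
`D(P ∥ R) = ∫ log (dP/dR) dP` if `P ≪ R` and the log-likelihood ratio is
`P`-integrable, and `+∞` otherwise. -/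
noncomputable def klDiv {α : Type*} [MeasurableSpace α] (P R : Measure α) : EReal :=
  if P ≪ R ∧ Integrable (llr P R) P then ((∫ x, llr P R x ∂P : ℝ) : EReal) else ⊤

/-- Joint law of `(X, Y)` where `X ~ Q` and `Y = X + Z` with `Z ~ N(0, σ²)`
independent of `X`. -/
noncomputable def jointLaw (σ : ℝ) (Q : Measure ℝ) : Measure (ℝ × ℝ) :=
  (Q.prod (gaussianReal 0 ⟨σ ^ 2, sq_nonneg σ⟩)).map (fun p => (p.1, p.1 + p.2))

/-- Mutual information `I(X;Y)` in nats: the KL divergence of the joint law of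
`(X, Y)` from the product of its marginal laws. -/
noncomputable def mutualInfo (σ : ℝ) (Q : Measure ℝ) : EReal :=
  klDiv (jointLaw σ Q) (((jointLaw σ Q).map Prod.fst).prod ((jointLaw σ Q).map Prod.snd))

/-- Capacity `C(A, E)` of the channel `Y = X + Z`, `Z ~ N(0, σ²)`, with peak-power
constraint `A` (i.e. `P(0 ≤ X ≤ A) = 1`) and average-power constraint `E[X] ≤ E`:
the supremum of the mutual information over all admissible input laws. -/
noncomputable def capacity (σ A E : ℝ) : EReal :=
  ⨆ Q ∈ {Q : Measure ℝ | IsProbabilityMeasure Q ∧ Q (Set.Icc 0 A) = 1 ∧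
      ∫⁻ x, ENNReal.ofReal x ∂Q ≤ ENNReal.ofReal E}, mutualInfo σ Q

open scoped ENNReal

lemma kl_bridge {α : Type*} [MeasurableSpace α] (P R : Measure α) [IsProbabilityMeasure P]
    [IsProbabilityMeasure R] : klDiv P R = ((InformationTheory.klDiv P R : ℝ≥0∞) : EReal) := by
  by_cases h : P ≪ R ∧ Integrable (llr P R) P
  · have h1 := InformationTheory.integral_llr_add_sub_measure_univ_nonneg h.1 h.2
    rw [klDiv, if_pos h, InformationTheory.klDiv_of_ac_of_integrable h.1 h.2]
    simp only [probReal_univ, add_sub_cancel_right] at h1 ⊢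
    rw [EReal.coe_ennreal_ofReal, max_eq_left h1]
  · have : InformationTheory.klDiv P R = ∞ := by
      rw [InformationTheory.klDiv_eq_top_iff]
      intro h1 h2
      exact h ⟨h1, h2⟩
    rw [klDiv, if_neg h, this]
    rfl

lemma kl_map_equiv {α : Type*} [MeasurableSpace α] (P R : Measure α) [IsProbabilityMeasure P]
    [IsProbabilityMeasure R] (T : α → α) (hT : Measurable T) (hTT : ∀ x, T (T x) = x) :
    InformationTheory.klDiv (P.map T) (R.map T) = InformationTheory.klDiv P R := by
  have := Measure.isProbabilityMeasure_map (μ := P) hT.aemeasurable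
  have := Measure.isProbabilityMeasure_map (μ := R) hT.aemeasurable
  refine le_antisymm (InformationTheory.klDiv_map_le P R hT) ?_
  have h := InformationTheory.klDiv_map_le (P.map T) (R.map T) hT
  have hid : T ∘ T = id := funext hTT
  rwa [Measure.map_map hT hT, Measure.map_map hT hT, hid, Measure.map_id, Measure.map_id] at h

lemma kl_golden (P : Measure (ℝ × ℝ)) [IsProbabilityMeasure P] (Q R : Measure ℝ)
    [IsProbabilityMeasure Q] [IsProbabilityMeasure R] :
    InformationTheory.klDiv P (Q.prod (P.map Prod.snd))
      ≤ InformationTheory.klDiv P (Q.prod R) := by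
  set S := P.map Prod.swap with hS
  have : IsProbabilityMeasure S := Measure.isProbabilityMeasure_map measurable_swap.aemeasurable
  have hfst : S.fst = P.map Prod.snd := by
    rw [Measure.fst, hS, Measure.map_map measurable_fst measurable_swap]; rfl
  have hdis : S.fst ⊗ₘ S.condKernel = S := S.disintegrate S.condKernel
  have : IsProbabilityMeasure (P.map Prod.snd) :=
    Measure.isProbabilityMeasure_map measurable_snd.aemeasurable
  have key : ∀ R' : Measure ℝ, IsProbabilityMeasure R' →
      InformationTheory.klDiv P (Q.prod R') =
      InformationTheory.klDiv (S.fst ⊗ₘ S.condKernel) (R' ⊗ₘ Kernel.const ℝ Q) := by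
    intro R' _
    rw [hdis, Measure.compProd_const]
    refine le_antisymm ?_ ?_
    · have h := InformationTheory.klDiv_map_le S (R'.prod Q) measurable_swap
      rwa [Measure.prod_swap, hS, Measure.map_map measurable_swap measurable_swap,
        Prod.swap_swap_eq, Measure.map_id] at h
    · have h := InformationTheory.klDiv_map_le P (Q.prod R') measurable_swap
      rwa [Measure.prod_swap] at h
  rw [key _ inferInstance, key R inferInstance,
    InformationTheory.klDiv_compProd_eq_add (ν := R), ← hfst]
  exact le_add_self

lemma kl_kernel (Q : Measure ℝ) [IsProbabilityMeasure Q] (κ η : Kernel ℝ ℝ) [IsMarkovKernel κ]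
    [IsMarkovKernel η] (h : ∀ᵐ x ∂Q, κ x ≪ η x) :
    InformationTheory.klDiv (Q ⊗ₘ κ) (Q ⊗ₘ η) =
      ∫⁻ p, ENNReal.ofReal (InformationTheory.klFun (Kernel.rnDeriv κ η p.1 p.2).toReal)
        ∂(Q ⊗ₘ η) := by
  have hm : Measurable (fun p : ℝ × ℝ => Kernel.rnDeriv κ η p.1 p.2) :=
    Kernel.measurable_rnDeriv κ η
  have h1 : Q ⊗ₘ κ = (Q ⊗ₘ η).withDensity (fun p => Kernel.rnDeriv κ η p.1 p.2) := by
    rw [← Measure.compProd_withDensity hm]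
    refine Measure.compProd_congr ?_
    filter_upwards [h] with x hx
    have h2 := Kernel.rnDeriv_add_singularPart κ η
    have h3 : Kernel.singularPart κ η x = 0 :=
      (Kernel.singularPart_eq_zero_iff_absolutelyContinuous κ η x).2 hx
    conv_lhs => rw [← h2]
    simp [h3]
  have hac : Q ⊗ₘ κ ≪ Q ⊗ₘ η := by rw [h1]; exact withDensity_absolutelyContinuous _ _
  rw [InformationTheory.klDiv_eq_lintegral_klFun_of_ac hac]
  refine lintegral_congr_ae ?_
  have h4 : (Q ⊗ₘ κ).rnDeriv (Q ⊗ₘ η) =ᵐ[Q ⊗ₘ η] fun p => Kernel.rnDeriv κ η p.1 p.2 := by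
    conv_lhs => rw [h1]
    exact Measure.rnDeriv_withDensity _ hm
  filter_upwards [h4] with p hp
  rw [hp]

lemma kl_avg (Q₁ Q₂ : Measure ℝ) [IsProbabilityMeasure Q₁] [IsProbabilityMeasure Q₂]
    [IsProbabilityMeasure ((2⁻¹ : ℝ≥0∞) • (Q₁ + Q₂))]
    (κ η : Kernel ℝ ℝ) [IsMarkovKernel κ] [IsMarkovKernel η]
    (he : InformationTheory.klDiv (Q₁ ⊗ₘ κ) (Q₁ ⊗ₘ η) = InformationTheory.klDiv (Q₂ ⊗ₘ κ) (Q₂ ⊗ₘ η)) :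
    InformationTheory.klDiv (Q₁ ⊗ₘ κ) (Q₁ ⊗ₘ η) ≤
    InformationTheory.klDiv (((2⁻¹ : ℝ≥0∞) • (Q₁ + Q₂)) ⊗ₘ κ) (((2⁻¹ : ℝ≥0∞) • (Q₁ + Q₂)) ⊗ₘ η) := by
  by_cases hac : ((2⁻¹ : ℝ≥0∞) • (Q₁ + Q₂)) ⊗ₘ κ ≪ ((2⁻¹ : ℝ≥0∞) • (Q₁ + Q₂)) ⊗ₘ η
  swap
  · rw [InformationTheory.klDiv_of_not_ac hac]; exact le_top
  have h : ∀ᵐ x ∂((2⁻¹ : ℝ≥0∞) • (Q₁ + Q₂)), κ x ≪ η x := hac.kernel_of_compProd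
  have h' := h
  rw [Measure.ae_ennreal_smul_measure_iff (by simp), ae_add_measure_iff] at h'
  rw [kl_kernel _ κ η h, Measure.compProd_smul_left, Measure.compProd_add_left,
    lintegral_smul_measure, lintegral_add_measure, ← kl_kernel _ κ η h'.1,
    ← kl_kernel _ κ η h'.2, ← he, ← two_mul, smul_eq_mul, ← mul_assoc,
    ENNReal.inv_mul_cancel (by simp) (by simp), one_mul]

noncomputable def chanV (σ : ℝ) : NNReal := ⟨σ ^ 2, sq_nonneg σ⟩

lemma jointLaw_def (σ : ℝ) (Q : Measure ℝ) : jointLaw σ Q =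
    (Q.prod (gaussianReal 0 (chanV σ))).map (fun p => (p.1, p.1 + p.2)) := rfl

noncomputable def chanW (σ : ℝ) : Kernel ℝ ℝ :=
  (Kernel.id ×ₖ Kernel.const ℝ (gaussianReal 0 (chanV σ))).map (fun p => p.1 + p.2)

instance chanW_markov (σ : ℝ) : IsMarkovKernel (chanW σ) := by
  unfold chanW
  exact Kernel.IsMarkovKernel.map _ (by fun_prop)

lemma jointLaw_eq (σ : ℝ) (Q : Measure ℝ) [IsProbabilityMeasure Q] :
    jointLaw σ Q = Q ⊗ₘ chanW σ := by
  ext s hs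
  have hm : Measurable (fun p : ℝ × ℝ => (p.1, p.1 + p.2)) := by fun_prop
  rw [jointLaw_def, Measure.map_apply hm hs, Measure.prod_apply (hm hs), Measure.compProd_apply hs]
  refine lintegral_congr fun x => ?_
  have hs' : MeasurableSet (Prod.mk x ⁻¹' s) := measurable_prodMk_left hs
  have hadd : Measurable (fun p : ℝ × ℝ => p.1 + p.2) := by fun_prop
  rw [chanW, Kernel.map_apply' _ hadd _ hs', Kernel.prod_apply, Kernel.id_apply, Kernel.const_apply,
    Measure.dirac_prod, Measure.map_apply measurable_prodMk_left (hadd hs')]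
  rfl

instance jointLaw_prob (σ : ℝ) (Q : Measure ℝ) [IsProbabilityMeasure Q] :
    IsProbabilityMeasure (jointLaw σ Q) := by
  rw [jointLaw_eq]; infer_instance

lemma jointLaw_refl (σ A : ℝ) (Q : Measure ℝ) [IsProbabilityMeasure Q] :
    jointLaw σ (Q.map (fun x => A - x)) =
      (jointLaw σ Q).map (Prod.map (fun x => A - x) (fun x => A - x)) := by
  have hr : Measurable (fun x : ℝ => A - x) := by fun_prop
  have hn : Measurable (fun x : ℝ => -x) := by fun_prop
  have hG : (gaussianReal 0 (chanV σ)).map (fun x => -x)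
      = gaussianReal 0 (chanV σ) := by
    rw [gaussianReal_map_neg, neg_zero]
  rw [jointLaw_def, jointLaw_def]
  conv_lhs => rw [← hG]
  rw [Measure.map_prod_map _ _ hr hn, Measure.map_map (by fun_prop) (by fun_prop),
    Measure.map_map (by fun_prop) (by fun_prop)]
  congr 1
  funext p
  simp only [Function.comp, Prod.map]
  ext <;> simp
  ring

lemma mutualInfo_eq (σ : ℝ) (Q : Measure ℝ) [IsProbabilityMeasure Q] :
    mutualInfo σ Q = ((InformationTheory.klDiv (jointLaw σ Q)
      (Q.prod ((jointLaw σ Q).map Prod.snd)) : ℝ≥0∞) : EReal) := by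
  have h : (jointLaw σ Q).map Prod.fst = Q := by
    rw [jointLaw_eq]; exact Measure.fst_compProd Q _
  have : IsProbabilityMeasure ((jointLaw σ Q).map Prod.snd) :=
    Measure.isProbabilityMeasure_map measurable_snd.aemeasurable
  rw [mutualInfo, h, kl_bridge]

lemma symm_prob (A : ℝ) (Q : Measure ℝ) [IsProbabilityMeasure Q] :
    IsProbabilityMeasure ((2⁻¹ : ℝ≥0∞) • (Q + Q.map (fun x => A - x))) := by
  have : IsProbabilityMeasure (Q.map (fun x => A - x)) :=
    Measure.isProbabilityMeasure_map (by fun_prop)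
  constructor
  simp only [Measure.smul_apply, Measure.add_apply, measure_univ, smul_eq_mul]
  rw [one_add_one_eq_two, ENNReal.inv_mul_cancel (by simp) (by simp)]

lemma mutualInfo_symm (σ A : ℝ) (Q : Measure ℝ) [IsProbabilityMeasure Q] :
    mutualInfo σ Q ≤ mutualInfo σ ((2⁻¹ : ℝ≥0∞) • (Q + Q.map (fun x => A - x))) := by
  have hr : Measurable (fun x : ℝ => A - x) := by fun_prop
  have : IsProbabilityMeasure (Q.map (fun x => A - x)) :=
    Measure.isProbabilityMeasure_map (by fun_prop)
  have hp := symm_prob A Q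
  have hsym : ((2⁻¹ : ℝ≥0∞) • (Q + Q.map (fun x => A - x))).map (fun x => A - x) =
      (2⁻¹ : ℝ≥0∞) • (Q + Q.map (fun x => A - x)) := by
    rw [Measure.map_smul, Measure.map_add _ _ hr, Measure.map_map hr hr]
    have : (fun x : ℝ => A - x) ∘ (fun x => A - x) = id := by funext x; simp
    rw [this, Measure.map_id, add_comm]
  rw [mutualInfo_eq, mutualInfo_eq, EReal.coe_ennreal_le_coe_ennreal_iff]
  set Q' := (2⁻¹ : ℝ≥0∞) • (Q + Q.map (fun x => A - x)) with hQ'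
  set R := (jointLaw σ Q').map Prod.snd with hR
  have : IsProbabilityMeasure R :=
    Measure.isProbabilityMeasure_map measurable_snd.aemeasurable
  have hRsym : R.map (fun x => A - x) = R := by
    conv_rhs => rw [hR, ← hsym, jointLaw_refl, Measure.map_map measurable_snd (by fun_prop)]
    rw [hR, Measure.map_map hr measurable_snd]
    rfl
  refine (kl_golden _ Q R).trans ?_
  have he : InformationTheory.klDiv (jointLaw σ Q) (Q.prod R) =
      InformationTheory.klDiv (jointLaw σ (Q.map (fun x => A - x)))
        ((Q.map (fun x => A - x)).prod R) := by
    conv_rhs => rw [← hRsym, jointLaw_refl, Measure.map_prod_map _ _ hr hr]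
    rw [kl_map_equiv _ _ _ (by fun_prop)]
    intro x
    simp [Prod.map]
  rw [jointLaw_eq, jointLaw_eq, ← Measure.compProd_const, ← Measure.compProd_const] at he
  rw [jointLaw_eq, jointLaw_eq, ← Measure.compProd_const, ← Measure.compProd_const]
  exact kl_avg _ _ _ _ he

/-- For `1/2 < α ≤ 1` the average-power constraint is inactive:
`C(A, αA) = C(A, A/2)`. -/
theorem inactive_average_power (σ A α : ℝ) (hσ : 0 < σ) (hA : 0 < A)
    (hα₁ : 1 / 2 < α) (hα₂ : α ≤ 1) :
    capacity σ A (α * A) = capacity σ A (A / 2) := by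
  refine le_antisymm ?_ ?_
  · refine iSup₂_le fun Q hQ => ?_
    obtain ⟨hp, hI, -⟩ := hQ
    refine (mutualInfo_symm σ A Q).trans ?_
    have hr : Measurable (fun x : ℝ => A - x) := by fun_prop
    refine le_iSup₂_of_le ((2⁻¹ : ℝ≥0∞) • (Q + Q.map (fun x => A - x))) ?_ le_rfl
    refine ⟨symm_prob A Q, ?_, ?_⟩
    · have : (fun x : ℝ => A - x) ⁻¹' (Icc 0 A) = Icc 0 A := by
        ext x; simp [and_comm]
      rw [Measure.smul_apply, Measure.add_apply, Measure.map_apply hr measurableSet_Icc, this, hI,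
        smul_eq_mul, one_add_one_eq_two, ENNReal.inv_mul_cancel (by simp) (by simp)]
    · have hae : ∀ᵐ x ∂Q, x ∈ Icc 0 A := by
        exact (mem_ae_iff_prob_eq_one₀ measurableSet_Icc.nullMeasurableSet).2 hI
      have hsum : ∫⁻ x, (ENNReal.ofReal x + ENNReal.ofReal (A - x)) ∂Q = ENNReal.ofReal A := by
        rw [lintegral_congr_ae (g := fun _ => ENNReal.ofReal A)]
        · simp
        · filter_upwards [hae] with x hx
          rw [← ENNReal.ofReal_add hx.1 (by linarith [hx.2])]
          congr 1; ring
      rw [lintegral_smul_measure, lintegral_add_measure, lintegral_map (by fun_prop) hr,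
        ← lintegral_add_left (by fun_prop), hsum, smul_eq_mul, ENNReal.ofReal_div_of_pos (by norm_num),
        ENNReal.div_eq_inv_mul]
      simp
  · refine iSup₂_le fun Q hQ => le_iSup₂_of_le Q ⟨hQ.1, hQ.2.1, hQ.2.2.trans ?_⟩ le_rfl
    exact ENNReal.ofReal_le_ofReal (by nlinarith)
end

section
/- For every σ > 0, A > 0 and 0 < α < 1/2, the capacity is upper-bounded as C(A, αA) ≤ (1/2)·log( 1 + α(1 − α)·A²/σ² ). -/
open MeasureTheory ProbabilityTheory Real Filter Set
open scoped Classical Topology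

open scoped ENNReal NNReal

noncomputable def outDens (v : ℝ≥0) (Q : Measure ℝ) (y : ℝ) : ℝ≥0∞ :=
  ∫⁻ x, gaussianPDF 0 v (y - x) ∂Q

noncomputable def chJoint (v : ℝ≥0) (Q : Measure ℝ) : Measure (ℝ × ℝ) :=
  (Q.prod (gaussianReal 0 v)).map (fun p => (p.1, p.1 + p.2))

lemma meas_ker (v : ℝ≥0) : Measurable (fun p : ℝ × ℝ => gaussianPDF 0 v (p.2 - p.1)) :=
  (measurable_gaussianPDF 0 v).comp (by fun_prop)

lemma meas_outDens (v : ℝ≥0) (Q : Measure ℝ) [IsProbabilityMeasure Q] :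
    Measurable (outDens v Q) := by
  unfold outDens
  exact Measurable.lintegral_prod_left' (f := fun p : ℝ × ℝ => gaussianPDF 0 v (p.2 - p.1))
    (meas_ker v)

lemma lintegral_joint (v : ℝ≥0) (hv : v ≠ 0) (Q : Measure ℝ) [IsProbabilityMeasure Q]
    (F : ℝ × ℝ → ℝ≥0∞) (hF : Measurable F) :
    ∫⁻ p, F p ∂(chJoint v Q)
      = ∫⁻ x, ∫⁻ y, gaussianPDF 0 v (y - x) * F (x, y) ∂volume ∂Q := by
  unfold chJoint
  rw [lintegral_map hF (by fun_prop), lintegral_prod _ (by fun_prop)]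
  refine lintegral_congr fun x => ?_
  rw [gaussianReal_of_var_ne_zero _ hv, lintegral_withDensity_eq_lintegral_mul _
    (measurable_gaussianPDF 0 v) (by fun_prop),
    ← lintegral_sub_right_eq_self (μ := volume) _ x]
  refine lintegral_congr fun y => ?_
  simp

lemma chJoint_fst (v : ℝ≥0) (Q : Measure ℝ) [IsProbabilityMeasure Q] :
    (chJoint v Q).map Prod.fst = Q := by
  unfold chJoint
  rw [Measure.map_map (by fun_prop) (by fun_prop)]
  have : (Prod.fst ∘ fun p : ℝ × ℝ => (p.1, p.1 + p.2)) = Prod.fst := rfl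
  rw [this, Measure.map_fst_prod]
  simp

lemma chJoint_snd (v : ℝ≥0) (hv : v ≠ 0) (Q : Measure ℝ) [IsProbabilityMeasure Q] :
    (chJoint v Q).map Prod.snd = volume.withDensity (outDens v Q) := by
  refine Measure.ext_of_lintegral _ fun F hF => ?_
  rw [lintegral_map hF measurable_snd, lintegral_joint v hv Q _ (by fun_prop),
    lintegral_withDensity_eq_lintegral_mul _ (meas_outDens v Q) hF, lintegral_lintegral_swap]
  · refine lintegral_congr fun y => ?_
    simp only [Pi.mul_apply, outDens]
    rw [lintegral_mul_const]
    exact (measurable_gaussianPDF 0 v).comp (by fun_prop)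
  · exact ((meas_ker v).mul (hF.comp measurable_snd)).aemeasurable

lemma pdf_le (v : ℝ≥0) (t : ℝ) : gaussianPDFReal 0 v t ≤ (√(2 * π * v))⁻¹ := by
  rw [gaussianPDFReal_def]
  have : Real.exp (-(t - 0) ^ 2 / (2 * (v:ℝ))) ≤ 1 := by
    rw [Real.exp_le_one_iff]
    apply div_nonpos_of_nonpos_of_nonneg
    · nlinarith [sq_nonneg t]
    · positivity
  calc _ ≤ (√(2 * π * v))⁻¹ * 1 := by
        beta_reduce
        exact mul_le_mul_of_nonneg_left this (by positivity)
    _ = _ := mul_one _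

lemma outDens_le (v : ℝ≥0) (Q : Measure ℝ) [IsProbabilityMeasure Q] (y : ℝ) :
    outDens v Q y ≤ ENNReal.ofReal (√(2 * π * v))⁻¹ := by
  unfold outDens
  calc _ ≤ ∫⁻ x, ENNReal.ofReal (√(2 * π * v))⁻¹ ∂Q :=
        lintegral_mono fun x => ENNReal.ofReal_le_ofReal (pdf_le v _)
    _ = _ := by simp

lemma le_outDens (v : ℝ≥0) (Q : Measure ℝ) [IsProbabilityMeasure Q] (A : ℝ)
    (hQ : ∀ᵐ x ∂Q, x ∈ Set.Icc 0 A) (x z : ℝ) (hx : x ∈ Set.Icc 0 A) :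
    ENNReal.ofReal ((√(2 * π * v))⁻¹ * Real.exp (-(2 * z ^ 2 + 2 * A ^ 2) / (2 * v)))
      ≤ outDens v Q (x + z) := by
  unfold outDens
  calc _ = ∫⁻ _, ENNReal.ofReal ((√(2 * π * v))⁻¹ *
        Real.exp (-(2 * z ^ 2 + 2 * A ^ 2) / (2 * v))) ∂Q := by simp
    _ ≤ _ := by
      refine lintegral_mono_ae ?_
      filter_upwards [hQ] with u hu
      apply ENNReal.ofReal_le_ofReal
      rw [gaussianPDFReal_def]
      have h1 : (x + z - u - 0) ^ 2 ≤ 2 * z ^ 2 + 2 * A ^ 2 := by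
        have : (x - u) ^ 2 ≤ A ^ 2 := by
          apply sq_le_sq' <;> linarith [hx.1, hx.2, hu.1, hu.2]
        nlinarith [sq_nonneg (x - u - z)]
      beta_reduce
      gcongr

lemma outDens_pos (v : ℝ≥0) (hv : v ≠ 0) (Q : Measure ℝ) [IsProbabilityMeasure Q] (y : ℝ) :
    outDens v Q y ≠ 0 := by
  intro h
  unfold outDens at h
  have hme : Measurable (fun x => gaussianPDF 0 v (y - x)) :=
    (measurable_gaussianPDF 0 v).comp (by fun_prop)
  rw [lintegral_eq_zero_iff hme] at h
  have : ∀ᵐ x ∂Q, False := by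
    filter_upwards [h] with x hx
    exact (gaussianPDF_pos 0 hv _).ne' hx
  simp at this
  exact IsProbabilityMeasure.ne_zero Q this

lemma outDens_ne_top (v : ℝ≥0) (Q : Measure ℝ) [IsProbabilityMeasure Q] (y : ℝ) :
    outDens v Q y ≠ ⊤ := ((outDens_le v Q y).trans_lt ENNReal.ofReal_lt_top).ne

noncomputable def ratio (v : ℝ≥0) (Q : Measure ℝ) (p : ℝ × ℝ) : ℝ≥0∞ :=
  gaussianPDF 0 v (p.2 - p.1) / outDens v Q p.2

lemma meas_ratio (v : ℝ≥0) (Q : Measure ℝ) [IsProbabilityMeasure Q] :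
    Measurable (ratio v Q) :=
  (meas_ker v).div ((meas_outDens v Q).comp measurable_snd)

lemma chJoint_eq (v : ℝ≥0) (hv : v ≠ 0) (Q : Measure ℝ) [IsProbabilityMeasure Q] :
    chJoint v Q = (Q.prod (volume.withDensity (outDens v Q))).withDensity (ratio v Q) := by
  refine Measure.ext_of_lintegral _ fun F hF => ?_
  have hm := meas_ratio v Q
  have hmo := meas_outDens v Q
  have : SFinite (volume.withDensity (outDens v Q)) := inferInstance
  rw [lintegral_joint v hv Q F hF, lintegral_withDensity_eq_lintegral_mul _ hm hF,
    lintegral_prod _ (hm.mul hF).aemeasurable]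
  refine lintegral_congr fun x => ?_
  have hme : Measurable (fun y => (ratio v Q * F) (x, y)) := (hm.mul hF).comp (by fun_prop)
  rw [lintegral_withDensity_eq_lintegral_mul _ hmo hme]
  refine lintegral_congr fun y => ?_
  simp only [Pi.mul_apply, ratio]
  rw [← mul_assoc, ENNReal.mul_div_cancel (outDens_pos v hv Q y) (outDens_ne_top v Q y)]

lemma llr_joint (v : ℝ≥0) (hv : v ≠ 0) (Q : Measure ℝ) [IsProbabilityMeasure Q] :
    chJoint v Q ≪ Q.prod (volume.withDensity (outDens v Q)) ∧
    llr (chJoint v Q) (Q.prod (volume.withDensity (outDens v Q))) =ᵐ[chJoint v Q]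
      fun p => Real.log (gaussianPDFReal 0 v (p.2 - p.1)) - Real.log (outDens v Q p.2).toReal := by
  have hac : chJoint v Q ≪ Q.prod (volume.withDensity (outDens v Q)) := by
    conv_lhs => rw [chJoint_eq v hv Q]
    exact withDensity_absolutelyContinuous _ _
  refine ⟨hac, ?_⟩
  have hp : IsProbabilityMeasure (chJoint v Q) := by
    unfold chJoint; exact Measure.isProbabilityMeasure_map (by fun_prop)
  have : IsProbabilityMeasure (volume.withDensity (outDens v Q)) := by
    rw [← chJoint_snd v hv Q]; exact Measure.isProbabilityMeasure_map (by fun_prop)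
  have h := Measure.rnDeriv_withDensity (Q.prod (volume.withDensity (outDens v Q)))
    (meas_ratio v Q)
  rw [← chJoint_eq v hv Q] at h
  filter_upwards [hac.ae_le h] with p hp
  rw [llr_def]
  simp only [hp, ratio, ENNReal.toReal_div, toReal_gaussianPDF]
  rw [Real.log_div (gaussianPDFReal_pos 0 v _ hv).ne']
  exact ENNReal.toReal_ne_zero.2 ⟨outDens_pos v hv Q _, outDens_ne_top v Q _⟩

lemma log_pdf (m : ℝ) (v : ℝ≥0) (hv : v ≠ 0) (t : ℝ) : Real.log (gaussianPDFReal m v t) =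
    Real.log (√(2 * π * v))⁻¹ - (t - m) ^ 2 / (2 * v) := by
  have hv' : (0:ℝ) < v := by positivity
  rw [gaussianPDFReal_def]
  simp only
  rw [Real.log_mul (by positivity) (by positivity), Real.log_exp]
  ring

lemma lintegral_gf (v w : ℝ≥0) (hv : v ≠ 0) (hw : w ≠ 0) (c : ℝ) (Q : Measure ℝ)
    [IsProbabilityMeasure Q] :
    ∫⁻ p, gaussianPDF c w (p.1 + p.2) / outDens v Q (p.1 + p.2) ∂(Q.prod (gaussianReal 0 v)) = 1 := by
  have hmo := meas_outDens v Q
  have hg := measurable_gaussianPDF c w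
  have hmeas : Measurable (fun y => gaussianPDF c w y / outDens v Q y) := hg.div hmo
  have h1 := lintegral_map (μ := chJoint v Q) hmeas measurable_snd
  rw [chJoint_snd v hv Q, lintegral_withDensity_eq_lintegral_mul _ hmo hmeas] at h1
  unfold chJoint at h1
  have hme : Measurable (fun a : ℝ × ℝ => gaussianPDF c w a.2 / outDens v Q a.2) :=
    hmeas.comp measurable_snd
  rw [lintegral_map hme (by fun_prop)] at h1
  rw [← h1, ← lintegral_gaussianPDF_eq_one c hw]
  refine lintegral_congr fun y => ?_
  simp only [Pi.mul_apply]
  rw [ENNReal.mul_div_cancel (outDens_pos v hv Q y) (outDens_ne_top v Q y)]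

lemma int_sq (v : ℝ≥0) : Integrable (fun z : ℝ => z ^ 2) (gaussianReal 0 v) ∧
    ∫ z, z ^ 2 ∂(gaussianReal 0 v) = v := by
  have hm : MemLp id 2 (gaussianReal 0 v) := by simpa using memLp_id_gaussianReal (μ := 0) (v := v) 2
  refine ⟨by simpa using hm.integrable_sq, ?_⟩
  have h := variance_eq_sub hm
  rw [variance_id_gaussianReal] at h
  simpa using h.symm

lemma main_bound (v w : ℝ≥0) (hv : v ≠ 0) (Q : Measure ℝ) [IsProbabilityMeasure Q]
    (A α : ℝ) (hA : 0 < A) (hα₀ : 0 < α) (hα : α < 1 / 2)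
    (hw : (w : ℝ) = v + α * (1 - α) * A ^ 2)
    (hQ : ∀ᵐ x ∂Q, x ∈ Set.Icc 0 A) (hE : ∫ x, x ∂Q ≤ α * A) :
    Integrable (llr (chJoint v Q) (Q.prod (volume.withDensity (outDens v Q)))) (chJoint v Q) ∧
    ∫ p, llr (chJoint v Q) (Q.prod (volume.withDensity (outDens v Q))) p ∂(chJoint v Q)
      ≤ 1 / 2 * Real.log (w / v) := by
  have hv' : (0:ℝ) < v := by positivity
  have hS : 0 < α * (1 - α) * A ^ 2 := by
    have : 0 < 1 - α := by linarith
    positivity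
  have hw' : (0:ℝ) < w := by rw [hw]; positivity
  have hw0 : w ≠ 0 := by
    rintro rfl; simp at hw'
  obtain ⟨_, hllr⟩ := llr_joint v hv Q
  have hmT : Measurable (fun p : ℝ × ℝ => (p.1, p.1 + p.2)) := by fun_prop
  set μ := Q.prod (gaussianReal 0 v) with hμ
  set L : ℝ × ℝ → ℝ := fun p => Real.log (gaussianPDFReal 0 v (p.2 - p.1))
    - Real.log (outDens v Q p.2).toReal with hL
  have hLm : Measurable L := by
    apply Measurable.sub
    · exact Real.measurable_log.comp ((measurable_gaussianPDFReal 0 v).comp (by fun_prop))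
    · exact Real.measurable_log.comp
        (ENNReal.measurable_toReal.comp ((meas_outDens v Q).comp measurable_snd))
  rw [integrable_congr hllr, integral_congr_ae hllr]
  unfold chJoint
  rw [integrable_map_measure hLm.aestronglyMeasurable hmT.aemeasurable,
    integral_map hmT.aemeasurable hLm.aestronglyMeasurable]
  have hx : ∀ᵐ p ∂μ, p.1 ∈ Set.Icc 0 A := Measure.quasiMeasurePreserving_fst.ae hQ
  obtain ⟨hi2, hv2⟩ := int_sq v
  have hi2' : Integrable (fun p : ℝ × ℝ => p.2 ^ 2) μ := hi2.comp_snd Q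
  have hint : Integrable (L ∘ fun p : ℝ × ℝ => (p.1, p.1 + p.2)) μ := by
    refine Integrable.mono' (g := fun p => (p.2 ^ 2 + A ^ 2) / v) ?_
      (hLm.comp hmT).aestronglyMeasurable ?_
    · exact (hi2'.add (integrable_const _)).div_const _
    · filter_upwards [hx] with p hp
      have h1 := outDens_le v Q (p.1 + p.2)
      have h2 := le_outDens v Q A hQ p.1 p.2 hp
      have h1' : (outDens v Q (p.1 + p.2)).toReal ≤ (√(2 * π * v))⁻¹ :=
        ENNReal.toReal_le_of_le_ofReal (by positivity) h1
      have h2' := (ENNReal.ofReal_le_iff_le_toReal (outDens_ne_top v Q _)).1 h2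
      have hpos : 0 < (√(2 * π * v))⁻¹ * Real.exp (-(2 * p.2 ^ 2 + 2 * A ^ 2) / (2 * v)) := by
        positivity
      have l1 := Real.log_le_log (hpos.trans_le h2') h1'
      have l2 := Real.log_le_log hpos h2'
      rw [Real.log_mul (by positivity) (by positivity), Real.log_exp] at l2
      simp only [Function.comp, hL, log_pdf 0 v hv, Real.norm_eq_abs]
      have e1 : (p.1 + p.2 - p.1 - 0) ^ 2 / (2 * (v:ℝ)) = p.2 ^ 2 / v / 2 := by
        field_simp; ring
      have e2 : -(2 * p.2 ^ 2 + 2 * A ^ 2) / (2 * (v:ℝ)) = - (p.2 ^ 2 / v) - A ^ 2 / v := by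
        field_simp; ring
      have e3 : (p.2 ^ 2 + A ^ 2) / (v:ℝ) = p.2 ^ 2 / v + A ^ 2 / v := by ring
      have n1 : 0 ≤ p.2 ^ 2 / (v:ℝ) := by positivity
      have n2 : 0 ≤ A ^ 2 / (v:ℝ) := by positivity
      rw [e1, e3, abs_le]
      rw [e2] at l2
      constructor <;> linarith
  refine ⟨hint, ?_⟩
  have hix : Integrable (fun x : ℝ => x) Q := by
    refine Integrable.mono' (integrable_const A) (by fun_prop) ?_
    filter_upwards [hQ] with x hx
    rw [Real.norm_eq_abs, abs_of_nonneg hx.1]; exact hx.2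
  have hiz : Integrable (fun z : ℝ => z) (gaussianReal 0 v) := by
    have := (memLp_id_gaussianReal (μ := 0) (v := v) 1).integrable (by simp)
    exact this
  have hz0 : ∫ z, z ∂(gaussianReal 0 v) = 0 := integral_id_gaussianReal
  have hix' : Integrable (fun p : ℝ × ℝ => p.1) μ := hix.comp_fst _
  have hixz : Integrable (fun p : ℝ × ℝ => (p.1 - α * A) * p.2) μ :=
    (hix.sub (integrable_const (α * A))).mul_prod hiz
  set r : ℝ × ℝ → ℝ≥0∞ := fun p => gaussianPDF (α * A) w (p.1 + p.2) / outDens v Q (p.1 + p.2)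
    with hr
  have hrm : Measurable r := ((measurable_gaussianPDF (α * A) w).comp (by fun_prop)).div
    ((meas_outDens v Q).comp (by fun_prop))
  have hr1 : ∫⁻ p, r p ∂μ = 1 := lintegral_gf v w hv hw0 (α * A) Q
  have hri : Integrable (fun p => (r p).toReal) μ :=
    integrable_toReal_of_lintegral_ne_top hrm.aemeasurable (by simp [hr1])
  have hrI : ∫ p, (r p).toReal ∂μ = 1 := by
    rw [integral_toReal hrm.aemeasurable (ae_lt_top hrm (by simp [hr1])), hr1]; simp
  set k : ℝ := Real.log (√(2 * π * v))⁻¹ - Real.log (√(2 * π * w))⁻¹ with hk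
  have hkeq : k = 1 / 2 * Real.log (w / v) := by
    rw [hk, Real.log_inv, Real.log_inv, Real.log_sqrt (by positivity),
      Real.log_sqrt (by positivity), Real.log_mul (by positivity) hv'.ne',
      Real.log_mul (by positivity) hw'.ne', Real.log_div hw'.ne' hv'.ne']
    ring
  set a : ℝ := 1 / (2 * v) with ha
  set b : ℝ := 1 / (2 * w) with hb
  have hb0 : 0 < b := by positivity
  -- pointwise bound
  set B : ℝ × ℝ → ℝ := fun p => (k - 1 + b * (α * A) ^ 2) + (b - a) * p.2 ^ 2
    + b * (A - 2 * (α * A)) * p.1 + 2 * b * ((p.1 - α * A) * p.2) + (r p).toReal with hB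
  have I1 : Integrable (fun p : ℝ × ℝ => (k - 1 + b * (α * A) ^ 2)) μ := integrable_const _
  have I2 := hi2'.const_mul (b - a)
  have I3 := hix'.const_mul (b * (A - 2 * (α * A)))
  have I4 := hixz.const_mul (2 * b)
  have hBi : Integrable B μ := (((I1.add I2).add I3).add I4).add hri
  have hle : ∫ p, L (p.1, p.1 + p.2) ∂μ ≤ ∫ p, B p ∂μ := by
    refine integral_mono_ae hint hBi ?_
    filter_upwards [hx] with p hp
    have fpos : 0 < (outDens v Q (p.1 + p.2)).toReal :=
      ENNReal.toReal_pos (outDens_pos v hv Q _) (outDens_ne_top v Q _)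
    have gpos := gaussianPDFReal_pos (α * A) w (p.1 + p.2) hw0
    have hlog := Real.log_le_sub_one_of_pos (div_pos gpos fpos)
    rw [Real.log_div gpos.ne' fpos.ne', log_pdf (α * A) w hw0] at hlog
    have e0 : (r p).toReal = gaussianPDFReal (α * A) w (p.1 + p.2)
        / (outDens v Q (p.1 + p.2)).toReal := by
      simp only [hr, ENNReal.toReal_div, toReal_gaussianPDF]
    simp only [hL, hB, log_pdf 0 v hv, e0]
    have e1 : (p.1 + p.2 - p.1 - 0) ^ 2 / (2 * (v:ℝ)) = a * p.2 ^ 2 := by rw [ha]; ring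
    have e2 : (p.1 + p.2 - α * A) ^ 2 / (2 * (w:ℝ)) = b * (p.1 + p.2 - α * A) ^ 2 := by
      rw [hb]; ring
    rw [e1]
    rw [e2] at hlog
    have hxx : b * (p.1 * (A - p.1)) ≥ 0 := by
      have := mul_nonneg hp.1 (sub_nonneg.2 hp.2)
      positivity
    linarith
  have hBI : ∫ p, B p ∂μ = (k - 1 + b * (α * A) ^ 2) + (b - a) * v
      + b * (A - 2 * (α * A)) * (∫ x, x ∂Q) + 1 := by
    have J2 : ∫ p, p.2 ^ 2 ∂μ = v := by
      rw [hμ, integral_fun_snd (fun z : ℝ => z ^ 2), hv2]; simp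
    have J3 : ∫ p, p.1 ∂μ = ∫ x, x ∂Q := by
      rw [hμ, integral_fun_fst (fun z : ℝ => z)]; simp
    have J4 : ∫ p, (p.1 - α * A) * p.2 ∂μ = 0 := by
      rw [hμ, integral_prod_mul (fun x : ℝ => x - α * A) (fun z : ℝ => z), hz0, mul_zero]
    simp only [hB]
    rw [integral_add (by exact ((I1.add I2).add I3).add I4) hri,
      integral_add (by exact (I1.add I2).add I3) I4,
      integral_add (by exact I1.add I2) I3, integral_add I1 I2, integral_const_mul, integral_const_mul,
      integral_const_mul, J2, J3, J4, hrI]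
    simp
  refine hle.trans ?_
  rw [hBI, ← hkeq]
  have h1 : b * (A - 2 * (α * A)) * (∫ x, x ∂Q) ≤ b * (A - 2 * (α * A)) * (α * A) := by
    have : 0 ≤ A - 2 * (α * A) := by nlinarith
    gcongr
  have h2 : a * v = 1 / 2 := by rw [ha]; field_simp
  have h3 : b * w = 1 / 2 := by rw [hb]; field_simp
  rw [hw] at h3
  nlinarith

theorem capacity_upper_bound_strong_low (σ A α : ℝ) (hσ : 0 < σ) (hA : 0 < A)
    (hα₀ : 0 < α) (hα : α < 1 / 2) :
    capacity σ A (α * A) ≤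
      ((1 / 2 * Real.log (1 + α * (1 - α) * A ^ 2 / σ ^ 2) : ℝ) : EReal) := by
  unfold capacity
  refine iSup₂_le fun Q hQ => ?_
  obtain ⟨hP, hQA, hQE⟩ := hQ
  have hae : ∀ᵐ x ∂Q, x ∈ Set.Icc 0 A := by
    exact (mem_ae_iff_prob_eq_one measurableSet_Icc).2 hQA
  have hE : ∫ x, x ∂Q ≤ α * A := by
    rw [integral_eq_lintegral_of_nonneg_ae (by filter_upwards [hae] with x hx using hx.1)
      (by fun_prop)]
    exact ENNReal.toReal_le_of_le_ofReal (by positivity) hQE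
  set v : ℝ≥0 := ⟨σ ^ 2, sq_nonneg σ⟩ with hvdef
  have hvc : (v : ℝ) = σ ^ 2 := rfl
  have hv : v ≠ 0 := by
    intro h
    have : (v : ℝ) = 0 := by rw [h]; rfl
    rw [hvc] at this
    exact (pow_pos hσ 2).ne' this
  have hS : 0 < α * (1 - α) * A ^ 2 := by
    have : 0 < 1 - α := by linarith
    positivity
  let w : ℝ≥0 := ⟨v + α * (1 - α) * A ^ 2, by positivity⟩
  have hm := main_bound v w hv Q A α hA hα₀ hα rfl hae hE
  have hj : jointLaw σ Q = chJoint v Q := rfl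
  unfold mutualInfo klDiv
  rw [hj, chJoint_fst, chJoint_snd v hv, if_pos ⟨(llr_joint v hv Q).1, hm.1⟩]
  have he : (w : ℝ) / v = 1 + α * (1 - α) * A ^ 2 / σ ^ 2 := by
    change ((v : ℝ) + α * (1 - α) * A ^ 2) / v = _
    rw [hvc]
    field_simp
  rw [← he]
  exact_mod_cast hm.2
end

section
/- For every σ > 0, A > 0, 0 < α < 1/2, and all free parameters μ > 0 and δ > 0, the capacity is upper-bounded as C(A, αA) ≤ (1 − Q((δ + αA)/σ) − Q((δ + (1−α)A)/σ)) · log( (A/σ) · (e^{μδ/A} − e^{−μ(1 + δ/A)}) / (√(2π)·μ·(1 − 2Q(δ/σ))) ) − 1/2 + Q(δ/σ) + (δ/(√(2π)σ))·e^{−δ²/(2σ²)} + (σ/A)·(μ/√(2π))·( e^{−δ²/(2σ²)} − e^{−(A+δ)²/(2σ²)} ) + μα·(1 − 2Q((δ + A/2)/σ)). -/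
open MeasureTheory ProbabilityTheory Real Filter Set
open scoped Classical Topology

/-- The Gaussian Q-function `Q(ξ) = ∫_ξ^∞ (1/√(2π)) e^{−t²/2} dt`. -/
noncomputable def Qf (ξ : ℝ) : ℝ := ∫ t in Set.Ioi ξ, (1 / Real.sqrt (2 * π)) * rexp (-t ^ 2 / 2)

noncomputable def wd (σ z : ℝ) : ℝ := 1 / (Real.sqrt (2 * π) * σ) * rexp (-z ^ 2 / (2 * σ ^ 2))

lemma wd_pos {σ : ℝ} (hσ : 0 < σ) (z : ℝ) : 0 < wd σ z := by
  unfold wd; positivity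

lemma wd_cont (σ : ℝ) : Continuous (wd σ) := by
  unfold wd; fun_prop

lemma wd_neg (σ z : ℝ) : wd σ (-z) = wd σ z := by
  unfold wd; congr 2; ring

lemma wd_anti {σ : ℝ} (hσ : 0 < σ) {a b : ℝ} (h : |a| ≤ |b|) : wd σ b ≤ wd σ a := by
  unfold wd
  have := sq_le_sq.mpr h
  gcongr

lemma log_wd {σ : ℝ} (hσ : 0 < σ) (z : ℝ) :
    Real.log (wd σ z) = -Real.log (Real.sqrt (2 * π) * σ) - z ^ 2 / (2 * σ ^ 2) := by
  unfold wd
  rw [Real.log_mul (by positivity) (by positivity), Real.log_exp, one_div, Real.log_inv]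
  ring

noncomputable def vv (σ : ℝ) : NNReal := ⟨σ ^ 2, sq_nonneg σ⟩

lemma vv_coe (σ : ℝ) : ((vv σ : NNReal) : ℝ) = σ ^ 2 := rfl

lemma jointLaw_eq_s3 (σ : ℝ) (Q : Measure ℝ) : jointLaw σ Q =
    (Q.prod (gaussianReal 0 (vv σ))).map (fun p => (p.1, p.1 + p.2)) := rfl

lemma var_ne {σ : ℝ} (hσ : 0 < σ) : vv σ ≠ 0 := by
  intro h
  have := congrArg NNReal.toReal h
  rw [vv_coe] at this
  simp at this
  exact hσ.ne' this

lemma pdf_eq {σ : ℝ} (hσ : 0 < σ) (z : ℝ) :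
    gaussianPDFReal 0 (vv σ) z = wd σ z := by
  rw [gaussianPDFReal_def]
  simp only [sub_zero, vv_coe, wd, one_div]
  rw [Real.sqrt_mul (by positivity), Real.sqrt_sq hσ.le]

lemma gauss_eq {σ : ℝ} (hσ : 0 < σ) :
    gaussianReal 0 (vv σ) =
      (volume : Measure ℝ).withDensity (fun z => ENNReal.ofReal (wd σ z)) := by
  rw [gaussianReal_of_var_ne_zero _ (var_ne hσ)]
  congr 1
  funext z
  rw [gaussianPDF, pdf_eq hσ]

lemma wd_integrable {σ : ℝ} (hσ : 0 < σ) : Integrable (wd σ) := by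
  have := integrable_gaussianPDFReal 0 (vv σ)
  convert this using 1
  funext z
  rw [pdf_eq hσ]

lemma wd_meas (σ : ℝ) : Measurable (fun z => ENNReal.ofReal (wd σ z)) :=
  ENNReal.measurable_ofReal.comp (wd_cont σ).measurable

lemma wd_meas2 (σ : ℝ) : Measurable (fun p : ℝ × ℝ => ENNReal.ofReal (wd σ (p.2 - p.1))) :=
  (wd_meas σ).comp (measurable_snd.sub measurable_fst)

noncomputable def Fq (σ : ℝ) (Q : Measure ℝ) (y : ℝ) : ENNReal :=
  ∫⁻ x, ENNReal.ofReal (wd σ (y - x)) ∂Q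

lemma Fq_meas (σ : ℝ) (Q : Measure ℝ) [SFinite Q] : Measurable (Fq σ Q) := by
  unfold Fq
  exact (wd_meas2 σ).lintegral_prod_left'

lemma joint_lintegral {σ : ℝ} (hσ : 0 < σ) (Q : Measure ℝ) [IsProbabilityMeasure Q]
    {φ : ℝ × ℝ → ENNReal} (hφ : Measurable φ) :
    ∫⁻ p, φ p ∂(jointLaw σ Q) = ∫⁻ x, (∫⁻ y, ENNReal.ofReal (wd σ (y - x)) * φ (x, y)) ∂Q := by
  have hT : Measurable (fun p : ℝ × ℝ => (p.1, p.1 + p.2)) := by fun_prop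
  rw [jointLaw_eq_s3]
  rw [lintegral_map hφ hT, lintegral_prod (fun p : ℝ × ℝ => φ (p.1, p.1 + p.2)) (hφ.comp hT).aemeasurable]
  refine lintegral_congr fun x => ?_
  rw [gauss_eq hσ, lintegral_withDensity_eq_lintegral_mul _ (wd_meas σ)
    (show Measurable fun z => φ (x, x + z) from hφ.comp (by fun_prop)),
    ← lintegral_add_left_eq_self (fun y => ENNReal.ofReal (wd σ (y - x)) * φ (x, y)) x]
  simp

instance joint_prob (σ : ℝ) (Q : Measure ℝ) [IsProbabilityMeasure Q] :
    IsProbabilityMeasure (jointLaw σ Q) := by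
  rw [jointLaw_eq_s3]
  exact Measure.isProbabilityMeasure_map (by fun_prop)

lemma joint_fst (σ : ℝ) (Q : Measure ℝ) [IsProbabilityMeasure Q] :
    (jointLaw σ Q).map Prod.fst = Q := by
  rw [jointLaw_eq_s3]
  rw [Measure.map_map measurable_fst (by fun_prop)]
  have : (Prod.fst ∘ fun p : ℝ × ℝ => (p.1, p.1 + p.2)) = Prod.fst := rfl
  rw [this, Measure.map_fst_prod]
  simp

lemma joint_snd {σ : ℝ} (hσ : 0 < σ) (Q : Measure ℝ) [IsProbabilityMeasure Q] :
    (jointLaw σ Q).map Prod.snd = (volume : Measure ℝ).withDensity (Fq σ Q) := by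
  refine Measure.ext_of_lintegral _ fun φ hφ => ?_
  rw [lintegral_map hφ measurable_snd, joint_lintegral hσ Q (φ := fun p => φ p.2) (hφ.comp measurable_snd),
    lintegral_withDensity_eq_lintegral_mul _ (Fq_meas σ Q) hφ, lintegral_lintegral_swap]
  · refine lintegral_congr fun y => ?_
    simp only [Pi.mul_apply, Fq]
    rw [lintegral_mul_const]
    exact (wd_meas σ).comp (by fun_prop)
  · exact ((wd_meas2 σ).mul (hφ.comp measurable_snd)).aemeasurable

lemma Fq_le {σ : ℝ} (hσ : 0 < σ) (Q : Measure ℝ) [IsProbabilityMeasure Q] (y : ℝ) :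
    Fq σ Q y ≤ ENNReal.ofReal (wd σ 0) := by
  unfold Fq
  calc _ ≤ ∫⁻ x, ENNReal.ofReal (wd σ 0) ∂Q :=
        lintegral_mono fun x => ENNReal.ofReal_le_ofReal (wd_anti hσ (by simp))
    _ = _ := by simp

lemma le_Fq {σ A : ℝ} (hσ : 0 < σ) (Q : Measure ℝ) [IsProbabilityMeasure Q]
    (hQ : ∀ᵐ x ∂Q, x ∈ Set.Icc 0 A) (y : ℝ) :
    ENNReal.ofReal (wd σ (|y| + A)) ≤ Fq σ Q y := by
  unfold Fq
  calc _ = ∫⁻ x, ENNReal.ofReal (wd σ (|y| + A)) ∂Q := by simp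
    _ ≤ _ := by
      refine lintegral_mono_ae ?_
      filter_upwards [hQ] with x hx
      refine ENNReal.ofReal_le_ofReal (wd_anti hσ ?_)
      have h1 := abs_sub y x
      rw [abs_of_nonneg hx.1] at h1
      have h2 : |y| + A ≤ |(|y| + A)| := le_abs_self _
      linarith [hx.2]

lemma Fq_ne_top {σ : ℝ} (hσ : 0 < σ) (Q : Measure ℝ) [IsProbabilityMeasure Q] (y : ℝ) :
    Fq σ Q y ≠ ⊤ := ((Fq_le hσ Q y).trans_lt ENNReal.ofReal_lt_top).ne

lemma Fq_ne_zero {σ A : ℝ} (hσ : 0 < σ) (Q : Measure ℝ) [IsProbabilityMeasure Q]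
    (hQ : ∀ᵐ x ∂Q, x ∈ Set.Icc 0 A) (y : ℝ) : Fq σ Q y ≠ 0 := by
  have := le_Fq hσ Q hQ y
  have h2 : 0 < ENNReal.ofReal (wd σ (|y| + A)) := ENNReal.ofReal_pos.mpr (wd_pos hσ _)
  exact (h2.trans_le this).ne'

lemma joint_withDensity {σ A : ℝ} (hσ : 0 < σ) (Q : Measure ℝ) [IsProbabilityMeasure Q]
    (hQ : ∀ᵐ x ∂Q, x ∈ Set.Icc 0 A) :
    jointLaw σ Q = (Q.prod ((jointLaw σ Q).map Prod.snd)).withDensity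
      (fun p => ENNReal.ofReal (wd σ (p.2 - p.1)) / Fq σ Q p.2) := by
  have hm : Measurable (fun p : ℝ × ℝ => ENNReal.ofReal (wd σ (p.2 - p.1)) / Fq σ Q p.2) :=
    (wd_meas2 σ).div ((Fq_meas σ Q).comp measurable_snd)
  refine Measure.ext_of_lintegral _ fun φ hφ => ?_
  rw [joint_lintegral hσ Q hφ, lintegral_withDensity_eq_lintegral_mul _ hm hφ, joint_snd hσ,
    lintegral_prod _ (hm.mul hφ).aemeasurable]
  refine lintegral_congr fun x => ?_
  rw [lintegral_withDensity_eq_lintegral_mul _ (Fq_meas σ Q)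
    (show Measurable fun y => ((fun p : ℝ × ℝ => ENNReal.ofReal (wd σ (p.2 - p.1)) /
      Fq σ Q p.2) * φ) (x, y) from
      (hm.mul hφ).comp (by fun_prop : Measurable fun y : ℝ => (x, y)))]
  refine lintegral_congr fun y => ?_
  simp only [Pi.mul_apply]
  rw [← mul_assoc, ENNReal.mul_div_cancel (Fq_ne_zero hσ Q hQ y) (Fq_ne_top hσ Q y)]

lemma llr_ae {σ A : ℝ} (hσ : 0 < σ) (Q : Measure ℝ) [IsProbabilityMeasure Q]
    (hQ : ∀ᵐ x ∂Q, x ∈ Set.Icc 0 A) :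
    jointLaw σ Q ≪ Q.prod ((jointLaw σ Q).map Prod.snd) ∧
    llr (jointLaw σ Q) (Q.prod ((jointLaw σ Q).map Prod.snd)) =ᵐ[jointLaw σ Q]
      fun p => Real.log (wd σ (p.2 - p.1)) - Real.log (Fq σ Q p.2).toReal := by
  have hm : Measurable (fun p : ℝ × ℝ => ENNReal.ofReal (wd σ (p.2 - p.1)) / Fq σ Q p.2) :=
    (wd_meas2 σ).div ((Fq_meas σ Q).comp measurable_snd)
  have : IsProbabilityMeasure ((jointLaw σ Q).map Prod.snd) :=
    Measure.isProbabilityMeasure_map (by fun_prop)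
  have hac : jointLaw σ Q ≪ Q.prod ((jointLaw σ Q).map Prod.snd) := by
    have := withDensity_absolutelyContinuous (Q.prod ((jointLaw σ Q).map Prod.snd))
      (fun p => ENNReal.ofReal (wd σ (p.2 - p.1)) / Fq σ Q p.2)
    rwa [← joint_withDensity hσ Q hQ] at this
  refine ⟨hac, ?_⟩
  have h := Measure.rnDeriv_withDensity (Q.prod ((jointLaw σ Q).map Prod.snd)) hm
  rw [← joint_withDensity hσ Q hQ] at h
  filter_upwards [hac.ae_le h] with p hp
  rw [llr, hp, ENNReal.toReal_div, ENNReal.toReal_ofReal (wd_pos hσ _).le, Real.log_div]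
  · exact (wd_pos hσ _).ne'
  · exact (ENNReal.toReal_pos (Fq_ne_zero hσ Q hQ _) (Fq_ne_top hσ Q _)).ne'

lemma mi_le {σ A : ℝ} (hσ : 0 < σ) (hA : 0 < A) (Q : Measure ℝ) [IsProbabilityMeasure Q]
    (hQ : ∀ᵐ x ∂Q, x ∈ Set.Icc 0 A) (r : ℝ → ℝ) (hr : Measurable r) (hr0 : ∀ y, 0 < r y)
    (hri : Integrable r) (hr1 : ∫ y, r y = 1) (B : ℝ → ℝ) (hB : Integrable B Q)
    (hH : ∀ x ∈ Set.Icc 0 A, ∃ H : ℝ → ℝ, Integrable H (gaussianReal 0 (vv σ)) ∧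
      (∀ z, Real.log (wd σ z) - Real.log (r (x + z)) ≤ H z) ∧
      ∫ z, H z ∂(gaussianReal 0 (vv σ)) ≤ B x) :
    mutualInfo σ Q ≤ ((∫ x, B x ∂Q : ℝ) : EReal) := by
  obtain ⟨hac, hllr⟩ := llr_ae hσ Q hQ
  have hT : Measurable (fun p : ℝ × ℝ => (p.1, p.1 + p.2)) := by fun_prop
  set N := gaussianReal 0 (vv σ) with hN
  set f : ℝ → ℝ := fun y => (Fq σ Q y).toReal with hf
  have hfm : Measurable f := (Fq_meas σ Q).ennreal_toReal
  have hf0 : ∀ y, 0 < f y := fun y =>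
    ENNReal.toReal_pos (Fq_ne_zero hσ Q hQ _) (Fq_ne_top hσ Q _)
  have hfle : ∀ y, f y ≤ wd σ 0 := fun y =>
    ENNReal.toReal_le_of_le_ofReal (wd_pos hσ _).le (Fq_le hσ Q y)
  have hlef : ∀ y, wd σ (|y| + A) ≤ f y := fun y =>
    (ENNReal.ofReal_le_iff_le_toReal (Fq_ne_top hσ Q y)).mp (le_Fq hσ Q hQ y)
  set ℓ : ℝ × ℝ → ℝ := fun p => Real.log (wd σ p.2) - Real.log (f (p.1 + p.2)) with hℓ
  have hℓm : Measurable ℓ :=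
    ((wd_cont σ).measurable.comp measurable_snd).log.sub
      (hfm.comp (measurable_fst.add measurable_snd)).log
  -- integrability of the explicit log-likelihood ratio
  have hℓi : Integrable ℓ (Q.prod N) := by
    have hz : Integrable (fun z : ℝ => (2 * z ^ 2 + 8 * A ^ 2) / (2 * σ ^ 2)) N := by
      have h2 : Integrable (fun z : ℝ => z ^ 2) N := by
        have := (memLp_id_gaussianReal (μ := 0) (v := (vv σ)) 2).integrable_sq
        simpa using this
      exact ((h2.const_mul 2).add (integrable_const _)).div_const _
    refine (hz.comp_snd Q).mono' hℓm.aestronglyMeasurable ?_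
    have hx : ∀ᵐ p ∂(Q.prod N), p.1 ∈ Set.Icc 0 A :=
      Measure.quasiMeasurePreserving_fst.ae hQ
    filter_upwards [hx] with p hp
    obtain ⟨x, z⟩ := p
    simp only [hℓ]
    have e1 : wd σ (|z| + 2 * A) ≤ f (x + z) := by
      refine le_trans (wd_anti hσ ?_) (hlef _)
      rw [abs_of_nonneg (a := |x + z| + A) (by positivity),
        abs_of_nonneg (a := |z| + 2 * A) (by positivity)]
      have := abs_add_le x z
      rw [abs_of_nonneg (show (0:ℝ) ≤ x from hp.1)] at this
      have := hp.2
      simp only at this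
      linarith
    have e2 : wd σ (|z| + 2 * A) ≤ wd σ z := by
      refine wd_anti hσ ?_
      rw [abs_of_nonneg (a := |z| + 2 * A) (by positivity)]
      linarith
    have l1 := Real.log_le_log (wd_pos hσ _) e1
    have l2 := Real.log_le_log (wd_pos hσ _) e2
    have l3 := Real.log_le_log (hf0 _) (hfle (x + z))
    have l4 := Real.log_le_log (wd_pos hσ _) (wd_anti hσ (by simp) : wd σ z ≤ wd σ 0)
    have key : Real.log (wd σ 0) - Real.log (wd σ (|z| + 2 * A)) ≤
        (2 * z ^ 2 + 8 * A ^ 2) / (2 * σ ^ 2) := by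
      rw [log_wd hσ, log_wd hσ]
      have : (|z| + 2 * A) ^ 2 / (2 * σ ^ 2) ≤ (2 * z ^ 2 + 8 * A ^ 2) / (2 * σ ^ 2) := by
        gcongr
        nlinarith [sq_nonneg (|z| - 2 * A), sq_abs z]
      simp only [ne_eq, OfNat.ofNat_ne_zero, not_false_eq_true, zero_pow, zero_div, sub_zero]
      linarith
    rw [Real.norm_eq_abs, abs_le]
    constructor <;> linarith
  -- transfer to the joint law
  set ℓ' : ℝ × ℝ → ℝ := fun p => Real.log (wd σ (p.2 - p.1)) - Real.log (Fq σ Q p.2).toReal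
    with hℓ'
  have hℓ'm : Measurable ℓ' :=
    ((wd_cont σ).measurable.comp (measurable_snd.sub measurable_fst)).log.sub
      (hfm.comp measurable_snd).log
  have hcomp : (ℓ' ∘ fun p : ℝ × ℝ => (p.1, p.1 + p.2)) = ℓ := by
    funext p
    simp [hℓ', hℓ, hf]
  have hℓ'i : Integrable ℓ' (jointLaw σ Q) := by
    rw [jointLaw_eq_s3]
    rw [integrable_map_measure hℓ'm.aestronglyMeasurable hT.aemeasurable, hcomp]
    exact hℓi
  have hint : ∫ p, ℓ' p ∂(jointLaw σ Q) = ∫ p, ℓ p ∂(Q.prod N) := by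
    rw [jointLaw_eq_s3]
    rw [integral_map hT.aemeasurable hℓ'm.aestronglyMeasurable, ← hcomp]
    rfl
  -- the ratio r / f
  set ρ : ℝ × ℝ → ℝ := fun p => r (p.1 + p.2) / f (p.1 + p.2) with hρ
  have hρm : Measurable ρ := (hr.div hfm).comp (measurable_fst.add measurable_snd)
  have hrf : Measurable fun y => ENNReal.ofReal (r y / f y) := (hr.div hfm).ennreal_ofReal
  have hρl : ∫⁻ p, ENNReal.ofReal (ρ p) ∂(Q.prod N) = 1 := by
    have h1 : ∫⁻ y, ENNReal.ofReal (r y / f y) ∂((jointLaw σ Q).map Prod.snd) = 1 := by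
      rw [joint_snd hσ, lintegral_withDensity_eq_lintegral_mul _ (Fq_meas σ Q) hrf]
      have : ∫⁻ y, ENNReal.ofReal (r y) = 1 := by
        rw [← ofReal_integral_eq_lintegral_ofReal hri (Eventually.of_forall fun y => (hr0 y).le),
          hr1, ENNReal.ofReal_one]
      rw [← this]
      refine lintegral_congr fun y => ?_
      simp only [Pi.mul_apply]
      have : Fq σ Q y = ENNReal.ofReal (f y) := (ENNReal.ofReal_toReal (Fq_ne_top hσ Q y)).symm
      rw [this, ← ENNReal.ofReal_mul (hf0 y).le, mul_div_cancel₀ _ (hf0 y).ne']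
    rw [lintegral_map hrf measurable_snd] at h1
    rw [jointLaw_eq_s3] at h1
    rw [lintegral_map (f := fun p : ℝ × ℝ => ENNReal.ofReal (r p.2 / f p.2))
      (hrf.comp measurable_snd) hT] at h1
    exact h1
  have hρ0 : ∀ p, 0 ≤ ρ p := fun p => (div_pos (hr0 _) (hf0 _)).le
  have hρi : Integrable ρ (Q.prod N) := by
    refine ⟨hρm.aestronglyMeasurable, ?_⟩
    rw [hasFiniteIntegral_iff_ofReal (Eventually.of_forall hρ0), hρl]
    exact ENNReal.one_lt_top
  have hρ1 : ∫ p, ρ p ∂(Q.prod N) = 1 := by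
    rw [integral_eq_lintegral_of_nonneg_ae (Eventually.of_forall hρ0) hρm.aestronglyMeasurable,
      hρl, ENNReal.toReal_one]
  set k : ℝ × ℝ → ℝ := fun p => ℓ p - ρ p + 1 with hk
  have hki : Integrable k (Q.prod N) := (hℓi.sub hρi).add (integrable_const _)
  have hkint : ∫ p, k p ∂(Q.prod N) = ∫ p, ℓ p ∂(Q.prod N) := by
    simp only [hk]
    rw [integral_add (f := fun p => ℓ p - ρ p) (hℓi.sub hρi) (integrable_const _), integral_sub hℓi hρi, hρ1]
    simp
  have hkle : ∫ p, k p ∂(Q.prod N) ≤ ∫ x, B x ∂Q := by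
    rw [integral_prod _ hki]
    refine integral_mono_ae hki.integral_prod_left hB ?_
    filter_upwards [hQ, hki.prod_right_ae] with x hx hkx
    obtain ⟨H, hHi, hHle, hHB⟩ := hH x hx
    refine le_trans (integral_mono hkx hHi fun z => ?_) hHB
    refine le_trans ?_ (hHle z)
    simp only [hk, hℓ, hρ]
    have := Real.log_le_sub_one_of_pos (div_pos (hr0 (x + z)) (hf0 (x + z)))
    rw [Real.log_div (hr0 _).ne' (hf0 _).ne'] at this
    linarith
  unfold mutualInfo klDiv
  rw [joint_fst, if_pos ⟨hac, hℓ'i.congr hllr.symm⟩, integral_congr_ae hllr]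
  rw [EReal.coe_le_coe_iff, hint, ← hkint]
  exact hkle

noncomputable def Gq (σ u : ℝ) : ℝ := ∫ z in (0:ℝ)..u, wd σ z

lemma wd_ii (σ a b : ℝ) : IntervalIntegrable (wd σ) volume a b :=
  (wd_cont σ).intervalIntegrable a b

lemma int_wd (σ a b : ℝ) : ∫ z in a..b, wd σ z = Gq σ b - Gq σ a := by
  unfold Gq
  rw [intervalIntegral.integral_interval_sub_left (wd_ii _ _ _) (wd_ii _ _ _)]

lemma Gq_neg (σ u : ℝ) : Gq σ (-u) = -Gq σ u := by
  unfold Gq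
  have := intervalIntegral.integral_comp_neg (a := 0) (b := u) (wd σ)
  simp only [wd_neg, neg_zero] at this
  rw [this, intervalIntegral.integral_symm]

lemma wd_Ioi_zero {σ : ℝ} (hσ : 0 < σ) : ∫ z in Set.Ioi 0, wd σ z = 1 / 2 := by
  unfold wd
  rw [integral_const_mul]
  have : ∀ z : ℝ, -z ^ 2 / (2 * σ ^ 2) = -(1 / (2 * σ ^ 2)) * z ^ 2 := fun z => by ring
  simp only [this]
  rw [integral_gaussian_Ioi]
  have : π / (1 / (2 * σ ^ 2)) = (2 * π) * σ ^ 2 := by field_simp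
  rw [this, Real.sqrt_mul (x := 2 * π) (by positivity) (σ ^ 2), Real.sqrt_sq hσ.le]
  field_simp

lemma wd_Ioi {σ : ℝ} (hσ : 0 < σ) (u : ℝ) : ∫ z in Set.Ioi u, wd σ z = 1 / 2 - Gq σ u := by
  have := intervalIntegral.integral_interval_add_Ioi (a := 0) (b := u) (f := wd σ) (μ := volume)
    (wd_integrable hσ).integrableOn (wd_integrable hσ).integrableOn
  rw [wd_Ioi_zero hσ] at this
  unfold Gq
  linarith

lemma Gq_one {σ : ℝ} (hσ : 0 < σ) (u : ℝ) : Gq 1 (u / σ) = Gq σ u := by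
  unfold Gq
  have := intervalIntegral.integral_comp_div (a := 0) (b := u) (wd 1) hσ.ne'
  rw [zero_div, smul_eq_mul] at this
  rw [eq_comm, ← mul_right_inj' hσ.ne', ← this, ← intervalIntegral.integral_const_mul]
  refine intervalIntegral.integral_congr fun z _ => ?_
  simp only [wd]
  have : -(z / σ) ^ 2 / (2 * 1 ^ 2) = -z ^ 2 / (2 * σ ^ 2) := by field_simp
  rw [this]
  field_simp

lemma Qf_eq {σ : ℝ} (hσ : 0 < σ) (u : ℝ) : Qf (u / σ) = 1 / 2 - Gq σ u := by
  rw [← Gq_one hσ, ← wd_Ioi one_pos]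
  simp [Qf, wd]

lemma tangent {σ : ℝ} (hσ : 0 < σ) {u v : ℝ} (hu : 0 ≤ u) (hv : 0 ≤ v) :
    Gq σ u ≤ Gq σ v + wd σ v * (u - v) := by
  rcases le_total v u with h | h
  · have : ∫ z in v..u, wd σ z ≤ ∫ z in v..u, wd σ v := by
      refine intervalIntegral.integral_mono_on h (wd_ii _ _ _) (by simp) fun z hz => ?_
      refine wd_anti hσ ?_
      rw [abs_of_nonneg hv, abs_of_nonneg (hv.trans hz.1)]
      exact hz.1
    rw [int_wd, intervalIntegral.integral_const, smul_eq_mul] at this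
    linarith
  · have : ∫ z in u..v, wd σ v ≤ ∫ z in u..v, wd σ z := by
      refine intervalIntegral.integral_mono_on h (by simp) (wd_ii _ _ _) fun z hz => ?_
      refine wd_anti hσ ?_
      rw [abs_of_nonneg hv, abs_of_nonneg (hu.trans hz.1)]
      exact hz.2
    rw [int_wd, intervalIntegral.integral_const, smul_eq_mul] at this
    linarith

lemma Gq_zero (σ : ℝ) : Gq σ 0 = 0 := by simp [Gq]

lemma Gq_pos {σ : ℝ} (hσ : 0 < σ) {u : ℝ} (hu : 0 < u) : 0 < Gq σ u :=
  intervalIntegral.intervalIntegral_pos_of_pos (wd_ii _ _ _) (wd_pos hσ) hu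

lemma wd_deriv {σ : ℝ} (hσ : 0 < σ) (z : ℝ) : HasDerivAt (wd σ) (-(z / σ ^ 2) * wd σ z) z := by
  unfold wd
  have h : HasDerivAt (fun z : ℝ => -z ^ 2 / (2 * σ ^ 2)) (-(z / σ ^ 2)) z := by
    have := ((hasDerivAt_pow 2 z).neg).div_const (2 * σ ^ 2)
    refine this.congr_deriv ?_
    push_cast
    field_simp
    try ring
  refine (h.exp.const_mul (1 / (Real.sqrt (2 * π) * σ))).congr_deriv ?_
  ring

lemma int_z {σ : ℝ} (hσ : 0 < σ) (a b : ℝ) :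
    ∫ z in a..b, wd σ z * z = σ ^ 2 * (wd σ a - wd σ b) := by
  have := intervalIntegral.integral_eq_sub_of_hasDerivAt (a := a) (b := b)
    (f := fun z => -σ ^ 2 * wd σ z) (f' := fun z => wd σ z * z) (fun z _ => by
      refine ((wd_deriv hσ z).const_mul (-σ ^ 2)).congr_deriv ?_
      field_simp) (((wd_cont σ).mul continuous_id).intervalIntegrable _ _)
  rw [this]
  ring

lemma int_z2 {σ : ℝ} (hσ : 0 < σ) (δ : ℝ) :
    ∫ z in (-δ)..δ, wd σ z * z ^ 2 = σ ^ 2 * (2 * Gq σ δ) - 2 * σ ^ 2 * δ * wd σ δ := by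
  have := intervalIntegral.integral_eq_sub_of_hasDerivAt (a := -δ) (b := δ)
    (f := fun z => -σ ^ 2 * (z * wd σ z)) (f' := fun z => wd σ z * z ^ 2 - σ ^ 2 * wd σ z)
    (fun z _ => by
      refine (((hasDerivAt_id z).mul (wd_deriv hσ z)).const_mul (-σ ^ 2)).congr_deriv ?_
      simp only [id]
      field_simp
      ring) ((((wd_cont σ).mul (continuous_pow 2)).sub
        (continuous_const.mul (wd_cont σ))).intervalIntegrable _ _)
  rw [intervalIntegral.integral_sub (f := fun z => wd σ z * z ^ 2)
    (g := fun z => σ ^ 2 * wd σ z) (((wd_cont σ).mul (continuous_pow 2)).intervalIntegrable _ _)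
    ((continuous_const.mul (wd_cont σ)).intervalIntegrable _ _),
    intervalIntegral.integral_const_mul, int_wd, Gq_neg, wd_neg] at this
  linarith

lemma gauss_ind {σ : ℝ} (hσ : 0 < σ) {a b : ℝ} (hab : a ≤ b) {φ : ℝ → ℝ} (hφ : Continuous φ) :
    Integrable ((Set.Icc a b).indicator φ) (gaussianReal 0 (vv σ)) ∧
    ∫ z, (Set.Icc a b).indicator φ z ∂(gaussianReal 0 (vv σ)) = ∫ z in a..b, wd σ z * φ z := by
  constructor
  · rw [integrable_indicator_iff measurableSet_Icc]
    exact hφ.continuousOn.integrableOn_compact isCompact_Icc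
  · rw [integral_gaussianReal_eq_integral_smul (var_ne hσ), intervalIntegral.integral_of_le hab,
      ← integral_Icc_eq_integral_Ioc, ← integral_indicator measurableSet_Icc]
    refine integral_congr_ae (Eventually.of_forall fun z => ?_)
    simp only [pdf_eq hσ, smul_eq_mul]
    by_cases hz : z ∈ Set.Icc a b <;> simp [hz]

noncomputable def rr (σ A δ c κ : ℝ) (y : ℝ) : ℝ :=
  if y < -δ then wd σ y else if y ≤ A + δ then κ * rexp (-c * y) else wd σ (y - A)

lemma rr_pos {σ A δ c κ : ℝ} (hσ : 0 < σ) (hκ : 0 < κ) (y : ℝ) : 0 < rr σ A δ c κ y := by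
  unfold rr
  have := wd_pos hσ y
  have := wd_pos hσ (y - A)
  split_ifs <;> positivity

lemma rr_eq {σ A δ c κ : ℝ} (hA : 0 < A) (hδ : 0 < δ) (y : ℝ) : rr σ A δ c κ y =
    (Set.Iio (-δ)).indicator (wd σ) y +
    (Set.Icc (-δ) (A + δ)).indicator (fun y => κ * rexp (-c * y)) y +
    (Set.Ioi δ).indicator (wd σ) (y - A) := by
  unfold rr
  split_ifs with h1 h2
  · rw [indicator_of_mem (by exact h1), indicator_of_notMem (by simp; intro; linarith),
      indicator_of_notMem (by simp; linarith)]
    simp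
  · rw [indicator_of_notMem (by exact h1), indicator_of_mem (by constructor <;> linarith),
      indicator_of_notMem (by simp; linarith)]
    simp
  · rw [indicator_of_notMem (by exact h1), indicator_of_notMem (by simp; intro; linarith),
      indicator_of_mem (by simp; linarith)]
    simp

lemma int_exp {c : ℝ} (hc : c ≠ 0) (a b : ℝ) :
    ∫ y in a..b, rexp (-c * y) = (rexp (-c * a) - rexp (-c * b)) / c := by
  have := intervalIntegral.integral_eq_sub_of_hasDerivAt (a := a) (b := b)
    (f := fun y => -(1 / c) * rexp (-c * y)) (f' := fun y => rexp (-c * y)) (fun y _ => by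
      have h : HasDerivAt (fun y : ℝ => -c * y) (-c) y := by
        simpa using (hasDerivAt_id y).const_mul (-c)
      refine (h.exp.const_mul (-(1 / c))).congr_deriv ?_
      field_simp) ((by fun_prop : Continuous fun y : ℝ => rexp (-c * y)).intervalIntegrable _ _)
  rw [this]
  field_simp
  ring

lemma rr_int {σ A δ c κ : ℝ} (hσ : 0 < σ) (hA : 0 < A) (hδ : 0 < δ) (hc : c ≠ 0) :
    Measurable (rr σ A δ c κ) ∧ Integrable (rr σ A δ c κ) ∧
    ∫ y, rr σ A δ c κ y = (1 - 2 * Gq σ δ) +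
      κ * ((rexp (c * δ) - rexp (-c * (A + δ))) / c) := by
  have e : rr σ A δ c κ = fun y => (Set.Iio (-δ)).indicator (wd σ) y +
    (Set.Icc (-δ) (A + δ)).indicator (fun y => κ * rexp (-c * y)) y +
    (Set.Ioi δ).indicator (wd σ) (y - A) := funext (rr_eq hA hδ)
  have i1 : Integrable ((Set.Iio (-δ)).indicator (wd σ)) :=
    (wd_integrable hσ).indicator measurableSet_Iio
  have i2 : Integrable ((Set.Icc (-δ) (A + δ)).indicator (fun y => κ * rexp (-c * y))) := by
    rw [integrable_indicator_iff measurableSet_Icc]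
    exact (by fun_prop : Continuous fun y : ℝ => κ * rexp (-c * y)).continuousOn.integrableOn_compact
      isCompact_Icc
  have i3' : Integrable ((Set.Ioi δ).indicator (wd σ)) :=
    (wd_integrable hσ).indicator measurableSet_Ioi
  have i3 : Integrable (fun y => (Set.Ioi δ).indicator (wd σ) (y - A)) := i3'.comp_sub_right A
  refine ⟨?_, ?_, ?_⟩
  · unfold rr
    refine Measurable.ite measurableSet_Iio (wd_cont σ).measurable
      (Measurable.ite measurableSet_Iic (by fun_prop) ?_)
    exact (wd_cont σ).measurable.comp (by fun_prop)
  · rw [e]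
    exact (i1.add i2).add i3
  · rw [e, integral_add (f := fun y => (Set.Iio (-δ)).indicator (wd σ) y +
      (Set.Icc (-δ) (A + δ)).indicator (fun y => κ * rexp (-c * y)) y) (i1.add i2) i3,
      integral_add i1 i2, integral_sub_right_eq_self (fun y => (Set.Ioi δ).indicator (wd σ) y),
      integral_indicator measurableSet_Iio, integral_indicator measurableSet_Ioi,
      integral_indicator measurableSet_Icc, integral_Icc_eq_integral_Ioc,
      ← intervalIntegral.integral_of_le (by linarith), intervalIntegral.integral_const_mul,
      int_exp hc, wd_Ioi hσ, ← integral_Iic_eq_integral_Iio]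
    have : ∫ z in Set.Iic (-δ), wd σ z = 1 / 2 - Gq σ δ := by
      rw [← wd_Ioi hσ, ← integral_comp_neg_Ioi]
      simp only [wd_neg]
    rw [this]
    simp only [mul_neg, neg_mul, neg_neg]
    ring

lemma int_H {σ A δ c L x : ℝ} (hσ : 0 < σ) (hA : 0 < A) (hδ : 0 < δ) :
    Integrable (fun z => (Set.Icc (-δ) δ).indicator (fun z => -z ^ 2 / (2 * σ ^ 2)) z +
      (Set.Icc (-δ - x) (A - x + δ)).indicator (fun z => L + c * (x + z)) z)
      (gaussianReal 0 (vv σ)) ∧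
    ∫ z, ((Set.Icc (-δ) δ).indicator (fun z => -z ^ 2 / (2 * σ ^ 2)) z +
      (Set.Icc (-δ - x) (A - x + δ)).indicator (fun z => L + c * (x + z)) z)
      ∂(gaussianReal 0 (vv σ)) = -Gq σ δ + δ * wd σ δ +
      (L + c * x) * (Gq σ (δ + (A - x)) + Gq σ (δ + x)) +
      c * (σ ^ 2 * (wd σ (δ + x) - wd σ (δ + (A - x)))) := by
  obtain ⟨i1, e1⟩ := gauss_ind hσ (show -δ ≤ δ by linarith)
    (show Continuous fun z : ℝ => -z ^ 2 / (2 * σ ^ 2) by fun_prop)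
  obtain ⟨i2, e2⟩ := gauss_ind hσ (show -δ - x ≤ A - x + δ by linarith)
    (show Continuous fun z : ℝ => L + c * (x + z) by fun_prop)
  refine ⟨i1.add i2, ?_⟩
  rw [integral_add i1 i2, e1, e2]
  have a1 : ∫ z in (-δ)..δ, wd σ z * (-z ^ 2 / (2 * σ ^ 2)) =
      (-1 / (2 * σ ^ 2)) * ∫ z in (-δ)..δ, wd σ z * z ^ 2 := by
    rw [← intervalIntegral.integral_const_mul]
    refine intervalIntegral.integral_congr fun z _ => ?_
    ring
  have a2 : ∫ z in (-δ - x)..(A - x + δ), wd σ z * (L + c * (x + z)) =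
      (L + c * x) * (∫ z in (-δ - x)..(A - x + δ), wd σ z) +
      c * ∫ z in (-δ - x)..(A - x + δ), wd σ z * z := by
    rw [← intervalIntegral.integral_const_mul, ← intervalIntegral.integral_const_mul,
      ← intervalIntegral.integral_add]
    · refine intervalIntegral.integral_congr fun z _ => ?_
      ring
    · exact (continuous_const.mul (wd_cont σ)).intervalIntegrable _ _
    · exact (continuous_const.mul ((wd_cont σ).mul continuous_id)).intervalIntegrable _ _
  rw [a1, a2, int_z2 hσ, int_z hσ, int_wd, show -δ - x = -(δ + x) by ring,
    show A - x + δ = δ + (A - x) by ring, Gq_neg, wd_neg]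
  field_simp
  ring

lemma H_bound {σ A δ c κ L x : ℝ} (hσ : 0 < σ) (hδ : 0 < δ) (hκ : 0 < κ)
    (hL : Real.log κ = -Real.log (Real.sqrt (2 * π) * σ) - L) (hx : x ∈ Set.Icc 0 A) (z : ℝ) :
    Real.log (wd σ z) - Real.log (rr σ A δ c κ (x + z)) ≤
      (Set.Icc (-δ) δ).indicator (fun z => -z ^ 2 / (2 * σ ^ 2)) z +
      (Set.Icc (-δ - x) (A - x + δ)).indicator (fun z => L + c * (x + z)) z := by
  obtain ⟨hx0, hxA⟩ := hx
  unfold rr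
  split_ifs with h1 h2
  · rw [indicator_of_notMem (by simp; intro; linarith), indicator_of_notMem
      (by simp; intro; linarith), log_wd hσ, log_wd hσ]
    have : (x + z) ^ 2 / (2 * σ ^ 2) ≤ z ^ 2 / (2 * σ ^ 2) := by
      gcongr 1
      nlinarith
    linarith
  · rw [indicator_of_mem (s := Set.Icc (-δ - x) (A - x + δ)) (by constructor <;> linarith),
      log_wd hσ, Real.log_mul hκ.ne' (Real.exp_pos _).ne', Real.log_exp, hL]
    have : -z ^ 2 / (2 * σ ^ 2) ≤ (Set.Icc (-δ) δ).indicator (fun z => -z ^ 2 / (2 * σ ^ 2)) z := by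
      by_cases hz : z ∈ Set.Icc (-δ) δ
      · rw [indicator_of_mem hz]
      · rw [indicator_of_notMem hz, neg_div]
        have : 0 ≤ z ^ 2 / (2 * σ ^ 2) := by positivity
        linarith
    rw [neg_div] at this
    linarith
  · rw [indicator_of_notMem (by simp; intro; linarith), indicator_of_notMem
      (by simp; intro; linarith), log_wd hσ, log_wd hσ]
    have : (x + z - A) ^ 2 / (2 * σ ^ 2) ≤ z ^ 2 / (2 * σ ^ 2) := by
      gcongr 1
      nlinarith
    linarith

/-- Duality-based upper bound on `C(A, αA)` for `0 < α < 1/2`, with free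
parameters `μ > 0` and `δ > 0`. -/
theorem capacity_upper_bound_strong_high (σ A α μ δ : ℝ) (hσ : 0 < σ) (hA : 0 < A)
    (hα₀ : 0 < α) (hα : α < 1 / 2) (hμ : 0 < μ) (hδ : 0 < δ) :
    capacity σ A (α * A) ≤
      (((1 - Qf ((δ + α * A) / σ) - Qf ((δ + (1 - α) * A) / σ)) *
          Real.log ((A / σ) * (rexp (μ * δ / A) - rexp (-μ * (1 + δ / A))) /
            (Real.sqrt (2 * π) * μ * (1 - 2 * Qf (δ / σ))))
        - 1 / 2 + Qf (δ / σ)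
        + δ / (Real.sqrt (2 * π) * σ) * rexp (-δ ^ 2 / (2 * σ ^ 2))
        + σ / A * (μ / Real.sqrt (2 * π)) *
            (rexp (-δ ^ 2 / (2 * σ ^ 2)) - rexp (-(A + δ) ^ 2 / (2 * σ ^ 2)))
        + μ * α * (1 - 2 * Qf ((δ + A / 2) / σ)) : ℝ) : EReal) := by
  have hc : 0 < μ / A := by positivity
  rw [Qf_eq hσ, Qf_eq hσ, Qf_eq hσ, Qf_eq hσ]
  have hG : 0 < Gq σ δ := Gq_pos hσ hδ
  set S : ℝ := rexp (μ * δ / A) - rexp (-μ * (1 + δ / A)) with hS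
  have hS2 : 2 * (μ * δ / A) ≤ S := by
    have h1 : μ * δ / A ≤ Real.sinh (μ * δ / A) := Real.self_le_sinh_iff.mpr (by positivity)
    rw [Real.sinh_eq] at h1
    have h2 : rexp (-μ * (1 + δ / A)) ≤ rexp (-(μ * δ / A)) := by
      apply Real.exp_le_exp.mpr
      have : -μ * (1 + δ / A) = -μ - μ * δ / A := by ring
      linarith
    linarith
  have hS0 : 0 < S := lt_of_lt_of_le (by positivity) hS2
  have e2G : 1 - 2 * (1 / 2 - Gq σ δ) = 2 * Gq σ δ := by ring
  rw [e2G]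
  set L : ℝ := Real.log (A / σ * S / (Real.sqrt (2 * π) * μ * (2 * Gq σ δ))) with hLdef
  set κ : ℝ := μ * (2 * Gq σ δ) / (A * S) with hκdef
  have hκ : 0 < κ := by positivity
  have hsq : 0 < Real.sqrt (2 * π) := by positivity
  have hL : Real.log κ = -Real.log (Real.sqrt (2 * π) * σ) - L := by
    have : A / σ * S / (Real.sqrt (2 * π) * μ * (2 * Gq σ δ)) =
        (Real.sqrt (2 * π) * σ * κ)⁻¹ := by
      rw [hκdef]
      field_simp
    rw [hLdef, this, Real.log_inv, Real.log_mul (by positivity) hκ.ne']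
    ring
  have hL0 : 0 ≤ L := by
    apply Real.log_nonneg
    rw [le_div_iff₀ (by positivity), one_mul]
    have ht := tangent hσ hδ.le le_rfl
    rw [Gq_zero] at ht
    have hw0 : Real.sqrt (2 * π) * wd σ 0 = 1 / σ := by
      unfold wd
      simp only [ne_eq, OfNat.ofNat_ne_zero, not_false_eq_true, zero_pow, neg_zero, zero_div,
        Real.exp_zero, mul_one]
      field_simp
    calc Real.sqrt (2 * π) * μ * (2 * Gq σ δ)
        ≤ Real.sqrt (2 * π) * μ * (2 * (wd σ 0 * δ)) := by
          gcongr
          linarith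
      _ = (Real.sqrt (2 * π) * wd σ 0) * (2 * (μ * δ)) := by ring
      _ = A / σ * (2 * (μ * δ / A)) := by rw [hw0]; field_simp
      _ ≤ A / σ * S := by gcongr
  obtain ⟨rm, ri, rI⟩ := rr_int (κ := κ) hσ hA hδ hc.ne'
  have rI1 : ∫ y, rr σ A δ (μ / A) κ y = 1 := by
    have x1 : μ / A * δ = μ * δ / A := by ring
    have x2 : -(μ / A) * (A + δ) = -μ * (1 + δ / A) := by field_simp
    rw [rI, x1, x2, ← hS, hκdef]
    field_simp
    ring
  have hαA : 0 < α * A := by positivity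
  have h1αA : 0 < (1 - α) * A := mul_pos (by linarith) hA
  set s : ℝ := wd σ (δ + α * A) - wd σ (δ + (1 - α) * A) with hs
  have hs0 : 0 ≤ s := by
    rw [hs, sub_nonneg]
    refine wd_anti hσ ?_
    rw [abs_of_pos (by linarith), abs_of_pos (by linarith)]
    nlinarith
  set C₀ : ℝ := -Gq σ δ + δ * wd σ δ +
    L * (Gq σ (δ + α * A) + Gq σ (δ + (1 - α) * A) - s * (α * A)) +
    μ / A * (σ ^ 2 * (wd σ δ - wd σ (A + δ))) with hC₀
  set D : ℝ := L * s + μ / A * (2 * Gq σ (δ + A / 2)) with hD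
  have hGA : 0 < Gq σ (δ + A / 2) := Gq_pos hσ (by positivity)
  have hD0 : 0 ≤ D := by positivity
  unfold capacity
  refine iSup₂_le fun Q hQ => ?_
  obtain ⟨hQp, hQ1, hQE⟩ := hQ
  have hQae : ∀ᵐ x ∂Q, x ∈ Set.Icc 0 A := (mem_ae_iff_prob_eq_one measurableSet_Icc).mpr hQ1
  have hxi : Integrable (fun x : ℝ => x) Q := by
    refine (integrable_const A).mono' measurable_id.aestronglyMeasurable ?_
    filter_upwards [hQae] with x hx
    rw [Real.norm_eq_abs, abs_of_nonneg hx.1]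
    exact hx.2
  have hxE : ∫ x, x ∂Q ≤ α * A := by
    rw [integral_eq_lintegral_of_nonneg_ae (f := fun x : ℝ => x)
      (by filter_upwards [hQae] with x hx using hx.1) measurable_id.aestronglyMeasurable]
    exact ENNReal.toReal_le_of_le_ofReal hαA.le hQE
  have hmi := mi_le hσ hA Q hQae (rr σ A δ (μ / A) κ) rm (rr_pos hσ hκ) ri rI1
    (fun x => C₀ + D * x) ((integrable_const _).add (hxi.const_mul D)) (fun x hx => by
      obtain ⟨hi, he⟩ := int_H (c := μ / A) (L := L) (x := x) hσ hA hδ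
      refine ⟨_, hi, H_bound hσ hδ hκ hL hx, ?_⟩
      rw [he]
      obtain ⟨hx0, hxA⟩ := hx
      have t1 := tangent hσ (u := δ + x) (v := δ + α * A) (by linarith) (by linarith)
      have t2 := tangent hσ (u := δ + (A - x)) (v := δ + (1 - α) * A) (by linarith) (by linarith)
      have t3 := tangent hσ (u := δ + x) (v := δ + A / 2) (by linarith) (by linarith)
      have t4 := tangent hσ (u := δ + (A - x)) (v := δ + A / 2) (by linarith) (by linarith)
      have w1 : wd σ (δ + x) ≤ wd σ δ := wd_anti hσ (by
        rw [abs_of_pos hδ, abs_of_pos (by linarith)]; linarith)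
      have w2 : wd σ (A + δ) ≤ wd σ (δ + (A - x)) := wd_anti hσ (by
        rw [abs_of_pos (by linarith), abs_of_pos (by linarith)]; linarith)
      have g1 : Gq σ (δ + (A - x)) + Gq σ (δ + x) ≤
          Gq σ (δ + α * A) + Gq σ (δ + (1 - α) * A) - s * (α * A) + s * x := by
        rw [hs]; linarith
      have g2 : Gq σ (δ + (A - x)) + Gq σ (δ + x) ≤ 2 * Gq σ (δ + A / 2) := by linarith
      have m1 := mul_le_mul_of_nonneg_left g1 hL0
      have m2 := mul_le_mul_of_nonneg_left g2 (mul_nonneg hc.le hx0)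
      have m3 : μ / A * (σ ^ 2 * (wd σ (δ + x) - wd σ (δ + (A - x)))) ≤
          μ / A * (σ ^ 2 * (wd σ δ - wd σ (A + δ))) := by gcongr
      rw [hC₀, hD]
      linarith)
  refine hmi.trans ?_
  rw [EReal.coe_le_coe_iff, integral_add (integrable_const _) (hxi.const_mul D),
    integral_const_mul]
  simp only [integral_const, probReal_univ, one_smul]
  have m4 := mul_le_mul_of_nonneg_left hxE hD0
  have f1 : δ / (Real.sqrt (2 * π) * σ) * rexp (-δ ^ 2 / (2 * σ ^ 2)) = δ * wd σ δ := by
    unfold wd; ring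
  have f2 : σ / A * (μ / Real.sqrt (2 * π)) *
      (rexp (-δ ^ 2 / (2 * σ ^ 2)) - rexp (-(A + δ) ^ 2 / (2 * σ ^ 2))) =
      μ / A * (σ ^ 2 * (wd σ δ - wd σ (A + δ))) := by
    unfold wd; field_simp
  have f3 : D * (α * A) = L * (s * (α * A)) + μ * α * (2 * Gq σ (δ + A / 2)) := by
    rw [hD]; field_simp
  rw [f1, f2, hC₀]
  rw [f3] at m4
  linarith
end
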